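/- arXiv:0901.2312 — 2 statements merged into one kernel-verified Lean document; each statement's English description precedes it below -/
import Mathlib

section
/- Let A be a unital star ℂ-algebra and let u, v ∈ A be unitary. Let S be the (unital) star subalgebra of M₂(A) generated by the union of the ranges π₁ᵘ(M₂(ℂ)) and π₂ᵛ(M₂(ℂ)). Then for every x in the unital star subalgebra of A generated by {u, v}, the matrix [[x,0],[0,0]] belongs to S. In particular the corner e₁₁·S·e₁₁ contains a copy of the star subalgebra of A generated by u and v. -/
/-- `π₁ᵘ : M₂(ℂ) → M₂(A)`, `[[a,b],[c,d]] ↦ [[a·1, b·u],[c·u*, d·1]]`. -/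
noncomputable def pi1 {A : Type*} [Ring A] [Algebra ℂ A] [StarRing A]
    (u : A) (M : Matrix (Fin 2) (Fin 2) ℂ) : Matrix (Fin 2) (Fin 2) A :=
  !![algebraMap ℂ A (M 0 0), M 0 1 • u;
     M 1 0 • star u, algebraMap ℂ A (M 1 1)]

/-- `π₂ᵛ : M₂(ℂ) → M₂(A)`. -/
noncomputable def pi2 {A : Type*} [Ring A] [Algebra ℂ A] [StarRing A]
    (v : A) (M : Matrix (Fin 2) (Fin 2) ℂ) : Matrix (Fin 2) (Fin 2) A :=
  (2 : ℂ)⁻¹ •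
    !![algebraMap ℂ A (M 0 0 + M 1 1) - M 1 0 • star v + M 0 1 • v,
       algebraMap ℂ A (M 0 0 - M 1 1) - M 1 0 • star v + M 0 1 • v;
       algebraMap ℂ A (M 0 0 - M 1 1) + M 1 0 • star v - M 0 1 • v,
       algebraMap ℂ A (M 0 0 + M 1 1) + M 1 0 • star v + M 0 1 • v]

/-- The copy `[[x,0],[0,0]]` of the star subalgebra generated by `s` lies in every star subalgebra
of `M₂(A)` that contains `e₁₁` and the corner copies of the elements of `s`. -/
theorem corner_mem_of_mem_adjoin {A : Type*} [Ring A] [Algebra ℂ A] [StarRing A] [StarModule ℂ A]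
    {s : Set A} (S : StarSubalgebra ℂ (Matrix (Fin 2) (Fin 2) A))
    (hone : !![1, 0; 0, 0] ∈ S) (hs : ∀ x ∈ s, !![x, 0; 0, 0] ∈ S)
    {x : A} (hx : x ∈ StarAlgebra.adjoin ℂ s) : !![x, 0; 0, 0] ∈ S := by
  induction hx using StarAlgebra.adjoin_induction with
  | mem x hx => exact hs x hx
  | algebraMap r =>
    convert S.smul_mem hone r using 1
    ext i j
    fin_cases i <;> fin_cases j <;> simp [Algebra.algebraMap_eq_smul_one]
  | add x y _ _ hx hy =>
    convert add_mem hx hy using 1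
    simp
  | mul x y _ _ hx hy =>
    convert mul_mem hx hy using 1
    simp
  | star x _ hx =>
    convert star_mem hx using 1
    ext i j
    fin_cases i <;> fin_cases j <;> simp [Matrix.star_apply]

/-- If `S` is the unital star subalgebra of `M₂(A)` generated by the ranges of
`π₁ᵘ` and `π₂ᵛ`, then for every `x` in the unital star subalgebra of `A`
generated by `{u, v}`, the matrix `[[x,0],[0,0]]` lies in `S`. -/
theorem corner_mem_adjoin_ranges {A : Type*} [Ring A] [Algebra ℂ A]
    [StarRing A] [StarModule ℂ A] (u v : A)
    (hu : u ∈ unitary A) (hv : v ∈ unitary A) :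
    ∀ x ∈ StarAlgebra.adjoin ℂ ({u, v} : Set A),
      !![x, 0; 0, 0] ∈
        StarAlgebra.adjoin ℂ (Set.range (pi1 u) ∪ Set.range (pi2 v)) := by
  intro x hx
  set S := StarAlgebra.adjoin ℂ (Set.range (pi1 u) ∪ Set.range (pi2 v))
  have h₁ (M : Matrix (Fin 2) (Fin 2) ℂ) : pi1 u M ∈ S :=
    StarAlgebra.subset_adjoin ℂ _ (Or.inl ⟨M, rfl⟩)
  have h₂ (M : Matrix (Fin 2) (Fin 2) ℂ) : (2 : ℂ) • pi2 v M ∈ S :=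
    S.smul_mem (StarAlgebra.subset_adjoin ℂ _ (Or.inr ⟨M, rfl⟩)) 2
  have e₁₁ : !![1, 0; 0, 0] ∈ S := by
    simpa [pi1] using h₁ !![1, 0; 0, 0]
  have e₂₂ : !![0, 0; 0, 1] ∈ S := by
    simpa [pi1] using h₁ !![0, 0; 0, 1]
  have e₂₁ : !![0, 0; 1, 0] ∈ S := by
    convert mul_mem (mul_mem e₂₂ (h₂ !![1, 0; 0, 0])) e₁₁ using 1
    ext i j
    fin_cases i <;> fin_cases j <;> simp [pi2]
  refine corner_mem_of_mem_adjoin S e₁₁ ?_ hx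
  rintro y (rfl | rfl)
  · convert mul_mem (h₁ !![0, 1; 0, 0]) e₂₁ using 1
    ext i j
    fin_cases i <;> fin_cases j <;> simp [pi1]
  · convert mul_mem (mul_mem e₁₁ (h₂ !![0, 1; 0, 0])) e₁₁ using 1
    ext i j
    fin_cases i <;> fin_cases j <;> simp [pi2]
end

section
/- Fix k ≥ 2, and let B be a unital star ℂ-algebra. Suppose π₁ : S₁ → B and π₂ : S₂ → B are *-algebra homomorphisms (ℂ-linear, multiplicative, star-preserving) from the block subalgebras S₁ ≅ M_k ⊕ ℂ and S₂ ≅ ℂ^{k−1} ⊕ M₂ of M_{k+1}(ℂ) which agree on all diagonal matrices, i.e. π₁(d) = π₂(d) for every diagonal matrix d ∈ M_{k+1}(ℂ). Then there exists a *-algebra homomorphism π : M_{k+1}(ℂ) → B such that π restricts to π₁ on S₁ and to π₂ on S₂. -/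
/-- The block subalgebra `S₁ ≅ M_k ⊕ ℂ` of `M_{k+1}(ℂ)`: all matrices whose
last row and last column vanish off the `(k+1,k+1)` entry. -/
def S1 (k : ℕ) : Set (Matrix (Fin (k + 1)) (Fin (k + 1)) ℂ) :=
  {M | ∀ i : Fin (k + 1), i ≠ Fin.last k →
    M i (Fin.last k) = 0 ∧ M (Fin.last k) i = 0}

/-- The block subalgebra `S₂ ≅ ℂ^{k−1} ⊕ M₂` of `M_{k+1}(ℂ)`: all matrices
`M` with `M i j = 0` whenever `i ≠ j` and `{i,j}` is not contained in the last
two indices (the `M₂` block occupies rows and columns `k` and `k+1`). -/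
def S2 (k : ℕ) : Set (Matrix (Fin (k + 1)) (Fin (k + 1)) ℂ) :=
  {M | ∀ i j : Fin (k + 1), i ≠ j →
    ¬(k - 1 ≤ (i : ℕ) ∧ k - 1 ≤ (j : ℕ)) → M i j = 0}

open Matrix

section PartialIsometries

variable {n B : Type*} [Fintype n] [Ring B] [Algebra ℂ B] [StarRing B]

/-- The linear map sending the matrix unit at `(i, j)` to `w i * star (w j)`. -/
def partialIsometryMap (w : n → B) (M : Matrix n n ℂ) : B :=
  ∑ i, ∑ j, M i j • (w i * star (w j))

theorem partialIsometryMap_add (w : n → B) (M N : Matrix n n ℂ) :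
    partialIsometryMap w (M + N) = partialIsometryMap w M + partialIsometryMap w N := by
  simp [partialIsometryMap, add_smul, Finset.sum_add_distrib]

theorem partialIsometryMap_smul (w : n → B) (c : ℂ) (M : Matrix n n ℂ) :
    partialIsometryMap w (c • M) = c • partialIsometryMap w M := by
  simp [partialIsometryMap, mul_smul, Finset.smul_sum]

theorem partialIsometryMap_star [StarModule ℂ B] (w : n → B) (M : Matrix n n ℂ) :
    partialIsometryMap w (star M) = star (partialIsometryMap w M) := by
  simp only [partialIsometryMap, star_sum, star_smul, star_mul, star_star, star_apply]
  exact Finset.sum_comm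

theorem partialIsometryMap_mul [DecidableEq n] {w : n → B} {e : B}
    (hw : ∀ i, w i * e = w i) (horth : ∀ i j, star (w i) * w j = if i = j then e else 0)
    (M N : Matrix n n ℂ) :
    partialIsometryMap w (M * N) = partialIsometryMap w M * partialIsometryMap w N := by
  have key : ∀ i j a b, w i * star (w j) * (w a * star (w b)) =
      if j = a then w i * star (w b) else 0 := by
    intro i j a b
    rw [mul_assoc, ← mul_assoc (star (w j)), horth, ← mul_assoc]
    split_ifs <;> simp [hw]
  simp only [partialIsometryMap, Finset.sum_mul, Finset.mul_sum, smul_mul_smul_comm, key,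
    smul_ite, smul_zero, mul_apply, Finset.sum_smul, Finset.sum_ite_eq',
    Finset.mem_univ, if_true]
  rw [Finset.sum_congr rfl fun i _ => Finset.sum_comm, Finset.sum_comm]
  exact Finset.sum_congr rfl fun j _ => Finset.sum_comm

end PartialIsometries

section BlockSubalgebras

variable {n B : Type*} [Fintype n] [DecidableEq n] [Ring B] [Algebra ℂ B]

theorem map_sum_of_add_on {A C ι : Type*} [AddCommMonoid A] [AddCommMonoid C] {S : Set A}
    {f : A → C} (hS : 0 ∈ S) (hSadd : ∀ x ∈ S, ∀ y ∈ S, x + y ∈ S) (hf : f 0 = 0)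
    (hadd : ∀ x ∈ S, ∀ y ∈ S, f (x + y) = f x + f y) (s : Finset ι) (g : ι → A)
    (hg : ∀ i ∈ s, g i ∈ S) : (∑ i ∈ s, g i) ∈ S ∧ f (∑ i ∈ s, g i) = ∑ i ∈ s, f (g i) := by
  classical
  induction s using Finset.induction_on with
  | empty => simpa using ⟨hS, hf⟩
  | insert a s ha ih =>
    obtain ⟨h₁, h₂⟩ := ih fun i hi => hg i (Finset.mem_insert_of_mem hi)
    have h₃ := hg a (Finset.mem_insert_self a s)
    rw [Finset.sum_insert ha, Finset.sum_insert ha, ← h₂]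
    exact ⟨hSadd _ h₃ _ h₁, hadd _ h₃ _ h₁⟩

/-- A linear map on a space `S` of matrices spanned by matrix units is determined by its values
on these units. -/
theorem partialIsometryMap_eq_of_units [StarRing B] {S : Set (Matrix n n ℂ)}
    {f : Matrix n n ℂ → B} {w : n → B} {P : n → n → Prop}
    (hSP : ∀ M, M ∈ S ↔ ∀ i j, ¬ P i j → M i j = 0)
    (hadd : ∀ M ∈ S, ∀ N ∈ S, f (M + N) = f M + f N)
    (hsmul : ∀ c : ℂ, ∀ M ∈ S, f (c • M) = c • f M)
    (hunit : ∀ i j, P i j → f (single i j 1) = w i * star (w j))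
    {M : Matrix n n ℂ} (hM : M ∈ S) : partialIsometryMap w M = f M := by
  have h0 : (0 : Matrix n n ℂ) ∈ S := (hSP 0).2 fun _ _ _ => rfl
  have hf0 : f 0 = 0 := by simpa using hsmul 0 0 h0
  have hSadd : ∀ x ∈ S, ∀ y ∈ S, x + y ∈ S := fun x hx y hy => (hSP _).2 fun i j hij => by
    simp [(hSP x).1 hx i j hij, (hSP y).1 hy i j hij]
  have hsingle : ∀ i j, P i j → ∀ c : ℂ, single i j c ∈ S := fun i j hij c =>
    (hSP _).2 fun a b hab => single_apply_of_ne _ _ _ _ _ (by rintro ⟨rfl, rfl⟩; exact hab hij)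
  have hterm : ∀ i j, single i j (M i j) ∈ S ∧
      f (single i j (M i j)) = M i j • (w i * star (w j)) := by
    intro i j
    by_cases hij : P i j
    · refine ⟨hsingle i j hij _, ?_⟩
      rw [← hunit i j hij, ← hsmul _ _ (hsingle i j hij 1), smul_single, smul_eq_mul, mul_one]
    · simp [(hSP M).1 hM i j hij, h0, hf0]
  have hrow := fun i => map_sum_of_add_on h0 hSadd hf0 hadd Finset.univ
    (fun j => single i j (M i j)) fun j _ => (hterm i j).1
  conv_rhs => rw [matrix_eq_sum_single M]
  rw [(map_sum_of_add_on h0 hSadd hf0 hadd Finset.univ _ fun i _ => (hrow i).1).2]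
  exact Finset.sum_congr rfl fun i _ => by
    rw [(hrow i).2]; exact Finset.sum_congr rfl fun j _ => (hterm i j).2.symm

theorem mem_S1_iff {k : ℕ} (M : Matrix (Fin (k + 1)) (Fin (k + 1)) ℂ) :
    M ∈ S1 k ↔ ∀ i j, ¬ (i = Fin.last k ↔ j = Fin.last k) → M i j = 0 := by
  refine ⟨fun h i j hij => ?_, fun h i hi => ⟨h _ _ (by simp [hi]), h _ _ (by simp [hi])⟩⟩
  by_cases hi : i = Fin.last k
  · subst hi
    exact (h j (by simpa using hij)).2
  · obtain rfl : j = Fin.last k := by simpa [hi] using hij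
    exact (h i hi).1

theorem mem_S2_iff {k : ℕ} (M : Matrix (Fin (k + 1)) (Fin (k + 1)) ℂ) :
    M ∈ S2 k ↔ ∀ i j : Fin (k + 1), ¬ (i = j ∨ (k - 1 ≤ (i : ℕ) ∧ k - 1 ≤ (j : ℕ))) → M i j = 0 := by
  simp only [S2, Set.mem_ofPred_eq, not_or, and_imp, ne_eq]

theorem single_mem_S1 {k : ℕ} {i j : Fin (k + 1)} (h : i = Fin.last k ↔ j = Fin.last k) :
    single i j (1 : ℂ) ∈ S1 k :=
  (mem_S1_iff _).2 fun a b hab =>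
    single_apply_of_ne _ _ _ _ _ (by rintro ⟨rfl, rfl⟩; exact hab h)

theorem single_mem_S2 {k : ℕ} {i j : Fin (k + 1)}
    (h : i = j ∨ (k - 1 ≤ (i : ℕ) ∧ k - 1 ≤ (j : ℕ))) : single i j (1 : ℂ) ∈ S2 k :=
  (mem_S2_iff _).2 fun a b hab =>
    single_apply_of_ne _ _ _ _ _ (by rintro ⟨rfl, rfl⟩; exact hab h)

end BlockSubalgebras

/-- If `π₁ : S₁ → B` and `π₂ : S₂ → B` are *-algebra homomorphisms which agree
on all diagonal matrices, then there is a *-algebra homomorphism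
`π : M_{k+1}(ℂ) → B` restricting to `π₁` on `S₁` and to `π₂` on `S₂`. -/
theorem exists_star_hom_extending (k : ℕ) (hk : 2 ≤ k)
    {B : Type*} [Ring B] [Algebra ℂ B] [StarRing B] [StarModule ℂ B]
    (π₁ π₂ : Matrix (Fin (k + 1)) (Fin (k + 1)) ℂ → B)
    (h1add : ∀ M ∈ S1 k, ∀ N ∈ S1 k, π₁ (M + N) = π₁ M + π₁ N)
    (h1smul : ∀ (c : ℂ), ∀ M ∈ S1 k, π₁ (c • M) = c • π₁ M)
    (h1mul : ∀ M ∈ S1 k, ∀ N ∈ S1 k, π₁ (M * N) = π₁ M * π₁ N)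
    (h1star : ∀ M ∈ S1 k, π₁ (star M) = star (π₁ M))
    (h2add : ∀ M ∈ S2 k, ∀ N ∈ S2 k, π₂ (M + N) = π₂ M + π₂ N)
    (h2smul : ∀ (c : ℂ), ∀ M ∈ S2 k, π₂ (c • M) = c • π₂ M)
    (h2mul : ∀ M ∈ S2 k, ∀ N ∈ S2 k, π₂ (M * N) = π₂ M * π₂ N)
    (h2star : ∀ M ∈ S2 k, π₂ (star M) = star (π₂ M))
    (hagree : ∀ d : Matrix (Fin (k + 1)) (Fin (k + 1)) ℂ, d.IsDiag → π₁ d = π₂ d) :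
    ∃ π : Matrix (Fin (k + 1)) (Fin (k + 1)) ℂ → B,
      (∀ M N, π (M + N) = π M + π N) ∧
      (∀ (c : ℂ) M, π (c • M) = c • π M) ∧
      (∀ M N, π (M * N) = π M * π N) ∧
      (∀ M, π (star M) = star (π M)) ∧
      (∀ M ∈ S1 k, π M = π₁ M) ∧
      (∀ M ∈ S2 k, π M = π₂ M) := by
  set q := Fin.last k with hq
  obtain ⟨p, hp⟩ : ∃ p : Fin (k + 1), (p : ℕ) = k - 1 := ⟨⟨k - 1, by omega⟩, rfl⟩
  have hpq : p ≠ q := fun h => by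
    have := congrArg Fin.val h
    simp only [hq, Fin.val_last] at this
    omega
  have hpk : k - 1 ≤ (p : ℕ) := hp.ge
  have hqk : k - 1 ≤ (q : ℕ) := by simp [hq]
  have hlast : ∀ i : Fin (k + 1), k - 1 ≤ (i : ℕ) → i = p ∨ i = q := fun i hi => by
    simp only [Fin.ext_iff, hq, Fin.val_last, hp]
    omega
  have hdiag : ∀ i, π₁ (single i i 1) = π₂ (single i i 1) := fun i =>
    hagree _ fun a b hab => single_apply_of_ne _ _ _ _ _ (by rintro ⟨rfl, rfl⟩; exact hab rfl)
  have hstar : ∀ i j : Fin (k + 1), star (single i j (1 : ℂ)) = single j i 1 := fun i j => by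
    rw [star_eq_conjTranspose, conjTranspose_single, star_one]
  have star₁ : ∀ i j, (i = q ↔ j = q) → star (π₁ (single i j 1)) = π₁ (single j i 1) :=
    fun i j h => by rw [← h1star _ (single_mem_S1 h), hstar]
  have star₂ : ∀ i j : Fin (k + 1), k - 1 ≤ (i : ℕ) → k - 1 ≤ (j : ℕ) →
      star (π₂ (single i j 1)) = π₂ (single j i 1) :=
    fun i j hi hj => by rw [← h2star _ (single_mem_S2 (.inr ⟨hi, hj⟩)), hstar]
  have mul₁ : ∀ i j l, (i = q ↔ j = q) → (j = q ↔ l = q) →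
      π₁ (single i j 1) * π₁ (single j l 1) = π₁ (single i l 1) := fun i j l h h' => by
    rw [← h1mul _ (single_mem_S1 h) _ (single_mem_S1 h'), single_mul_single_same, mul_one]
  have mul₂ : ∀ i j l : Fin (k + 1), k - 1 ≤ (i : ℕ) → k - 1 ≤ (j : ℕ) → k - 1 ≤ (l : ℕ) →
      π₂ (single i j 1) * π₂ (single j l 1) = π₂ (single i l 1) := fun i j l hi hj hl => by
    rw [← h2mul _ (single_mem_S2 (.inr ⟨hi, hj⟩)) _ (single_mem_S2 (.inr ⟨hj, hl⟩)),
      single_mul_single_same, mul_one]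
  have zero₁ : π₁ 0 = 0 := by
    simpa using h1smul 0 0 ((mem_S1_iff 0).2 fun _ _ _ => rfl)
  have ortho₁ : ∀ i j a b, (i = q ↔ j = q) → (a = q ↔ b = q) → j ≠ a →
      π₁ (single i j 1) * π₁ (single a b 1) = 0 := fun i j a b h h' hja => by
    rw [← h1mul _ (single_mem_S1 h) _ (single_mem_S1 h'), single_mul_single_of_ne _ _ _ _ hja,
      zero₁]
  let w : Fin (k + 1) → B := fun i => if i = q then π₂ (single q p 1) else π₁ (single i p 1)
  have wq : w q = π₂ (single q p 1) := if_pos rfl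
  have wne : ∀ i, i ≠ q → w i = π₁ (single i p 1) := fun i hi => if_neg hi
  have wp : w p = π₂ (single p p 1) := by rw [wne p hpq, hdiag]
  have hw : ∀ i, w i * π₁ (single p p 1) = w i := fun i => by
    by_cases hi : i = q
    · rw [hi, wq, hdiag, mul₂ _ _ _ hqk hpk hpk]
    · rw [wne i hi, mul₁ _ _ _ (by simp [hi, hpq]) Iff.rfl]
  have cross : ∀ i, i ≠ q → star (w q) * w i = 0 := fun i hi => by
    rw [wq, wne i hi, star₂ _ _ hqk hpk, ← mul₂ p q q hpk hqk hqk, ← hdiag, mul_assoc,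
      ortho₁ _ _ _ _ Iff.rfl (by simp [hi, hpq]) (Ne.symm hi), mul_zero]
  have horth : ∀ i j, star (w i) * w j = if i = j then π₁ (single p p 1) else 0 := by
    intro i j
    by_cases hi : i = q <;> by_cases hj : j = q
    · rw [hi, hj, if_pos rfl, wq, star₂ _ _ hqk hpk, mul₂ _ _ _ hpk hqk hpk, hdiag]
    · rw [hi, if_neg (Ne.symm hj), cross j hj]
    · rw [hj, if_neg hi, ← star_star (w q), ← star_mul, cross i hi, star_zero]
    · rw [wne i hi, wne j hj, star₁ _ _ (by simp [hi, hpq])]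
      split_ifs with hij
      · rw [hij, mul₁ _ _ _ (by simp [hj, hpq]) (by simp [hj, hpq])]
      · exact ortho₁ _ _ _ _ (by simp [hi, hpq]) (by simp [hj, hpq]) hij
  have unit₁ : ∀ i j, (i = q ↔ j = q) → π₁ (single i j 1) = w i * star (w j) := by
    intro i j h
    by_cases hi : i = q
    · rw [h.1 hi, hi, wq, star₂ _ _ hqk hpk, mul₂ _ _ _ hqk hpk hqk, hdiag]
    · have hj : j ≠ q := fun hj => hi (h.2 hj)
      rw [wne i hi, wne j hj, star₁ _ _ (by simp [hj, hpq]),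
        mul₁ _ _ _ (by simp [hi, hpq]) (by simp [hj, hpq])]
  have w_last : ∀ i : Fin (k + 1), k - 1 ≤ (i : ℕ) → w i = π₂ (single i p 1) := fun i hi => by
    obtain rfl | rfl := hlast i hi
    exacts [wp, wq]
  have unit₂ : ∀ i j : Fin (k + 1), (i = j ∨ (k - 1 ≤ (i : ℕ) ∧ k - 1 ≤ (j : ℕ))) →
      π₂ (single i j 1) = w i * star (w j) := by
    rintro i j (rfl | ⟨hi, hj⟩)
    · rw [← hdiag, unit₁ _ _ Iff.rfl]
    · rw [w_last i hi, w_last j hj, star₂ _ _ hj hpk, mul₂ _ _ _ hi hpk hj]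
  exact ⟨partialIsometryMap w, partialIsometryMap_add w, partialIsometryMap_smul w,
    partialIsometryMap_mul hw horth, partialIsometryMap_star w,
    fun _ hM => partialIsometryMap_eq_of_units mem_S1_iff h1add h1smul unit₁ hM,
    fun _ hM => partialIsometryMap_eq_of_units mem_S2_iff h2add h2smul unit₂ hM⟩
end
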